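/- Let G be a directed cyclic graph that contains k pairwise vertex-disjoint directed cycles, each of length at least 3. Then |MEC(G)| ≥ 2^k. -/

import Mathlib

namespace CausalMEC

/-- A directed graph on `Fin n`, given by a Boolean edge function (`d a b = true` means `a → b`). -/
abbrev Dir (n : ℕ) := Fin n → Fin n → Bool

/-- Directed reachability (zero or more steps). -/
def Reach {n : ℕ} (d : Dir n) : Fin n → Fin n → Prop :=
  Relation.ReflTransGen fun a b => d a b = true

/-- No directed cycles (including no self-loops). -/
def Acyclic {n : ℕ} (d : Dir n) : Prop :=
  ∀ v, ¬ Relation.TransGen (fun a b => d a b = true) v v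

/-- A directed acyclic graph. -/
def IsDAG {n : ℕ} (d : Dir n) : Prop :=
  (∀ v, d v v = false) ∧ Acyclic d

/-- A directed (possibly cyclic) graph with edges between distinct vertices. -/
def IsDCG {n : ℕ} (d : Dir n) : Prop :=
  ∀ v, d v v = false

/-- The number of directed edges. -/
def edgeCount {n : ℕ} (d : Dir n) : ℕ :=
  (Finset.univ.filter fun q : Fin n × Fin n => d q.1 q.2 = true).card

/-- The parent set of a vertex. -/
def parents {n : ℕ} (d : Dir n) (v : Fin n) : Finset (Fin n) :=
  Finset.univ.filter fun u => d u v = true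

/-! ### Paths, d-connection and Markov equivalence in mixed graphs
A mixed graph is given by a directed part `d` and a bidirected part `b`. -/

/-- The kind of a step on a path: a directed edge traversed forwards, a directed edge
traversed backwards, or a bidirected edge. -/
inductive EdgeKind : Type
  | fwd | bwd | bidir
deriving DecidableEq

/-- Does the step point into its second endpoint? -/
def EdgeKind.intoSnd : EdgeKind → Bool
  | .fwd => true
  | .bwd => false
  | .bidir => true

/-- Does the step point into its first endpoint? -/
def EdgeKind.intoFst : EdgeKind → Bool
  | .fwd => false
  | .bwd => true
  | .bidir => true

/-- A (possibly self-intersecting) path from `u` to `v` in the mixed graph `(d, b)`. -/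
structure MPath {n : ℕ} (d b : Dir n) (u v : Fin n) where
  len : ℕ
  vert : Fin (len + 1) → Fin n
  kind : Fin len → EdgeKind
  first_eq : vert 0 = u
  last_eq : vert (Fin.last len) = v
  valid : ∀ i : Fin len,
    (kind i = .fwd → d (vert i.castSucc) (vert i.succ) = true) ∧
    (kind i = .bwd → d (vert i.succ) (vert i.castSucc) = true) ∧
    (kind i = .bidir → b (vert i.castSucc) (vert i.succ) = true)

/-- Whether the internal vertex at position `i` of a path is a collider. -/
def MPath.colliderAt {n : ℕ} {d b : Dir n} {u v : Fin n} (π : MPath d b u v)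
    (i : ℕ) (h1 : 0 < i) (h2 : i < π.len) : Bool :=
  (π.kind ⟨i - 1, by omega⟩).intoSnd && (π.kind ⟨i, h2⟩).intoFst

/-- A path is active given a conditioning set `Z` if every non-collider on it avoids `Z`
and every collider on it is in `Z` or has a descendant in `Z`. -/
def MPath.Active {n : ℕ} {d b : Dir n} {u v : Fin n} (π : MPath d b u v)
    (Z : Finset (Fin n)) : Prop :=
  ∀ (i : ℕ) (h1 : 0 < i) (h2 : i < π.len),
    (π.colliderAt i h1 h2 = true →
      ∃ x ∈ Z, Reach d (π.vert ⟨i, by omega⟩) x) ∧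
    (π.colliderAt i h1 h2 = false →
      π.vert ⟨i, by omega⟩ ∉ Z)

/-- d-connection given a conditioning set. -/
def DConn {n : ℕ} (d b : Dir n) (u v : Fin n) (Z : Finset (Fin n)) : Prop :=
  ∃ π : MPath d b u v, π.Active Z

/-- Markov equivalence of two mixed graphs: the same d-connection relations. -/
def MarkovEquiv {n : ℕ} (d b d' b' : Dir n) : Prop :=
  ∀ (u v : Fin n) (Z : Finset (Fin n)), u ≠ v → u ∉ Z → v ∉ Z →
    (DConn d b u v Z ↔ DConn d' b' u v Z)

/-- The empty bidirected part: a purely directed graph. -/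
def noBi (n : ℕ) : Dir n := fun _ _ => false

/-- Markov equivalence for purely directed graphs. -/
def MarkovEquivD {n : ℕ} (d d' : Dir n) : Prop :=
  MarkovEquiv d (noBi n) d' (noBi n)

/-- The Markov equivalence class of a DAG (within DAGs). -/
def MECdag {n : ℕ} (d : Dir n) : Set (Dir n) :=
  {d' | IsDAG d' ∧ MarkovEquivD d d'}

/-- An acyclic directed mixed graph. -/
def IsADMG {n : ℕ} (d b : Dir n) : Prop :=
  IsDAG d ∧ (∀ v w, b v w = b w v) ∧ (∀ v, b v v = false)

/-- The Markov equivalence class of an ADMG (within ADMGs). -/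
def MECadmg {n : ℕ} (d b : Dir n) : Set (Dir n × Dir n) :=
  {G | IsADMG G.1 G.2 ∧ MarkovEquiv d b G.1 G.2}

/-- The Markov equivalence class of a DCG (within DCGs). -/
def MECdcg {n : ℕ} (d : Dir n) : Set (Dir n) :=
  {d' | IsDCG d' ∧ MarkovEquivD d d'}

/-! ### The distribution `D(n,p)` and uniform ADMGs/DCGs -/

/-- The (unnormalized) weight of a DAG under `D(n,p)`. -/
noncomputable def dagWeight {n : ℕ} (p : ℝ) (d : Dir n) : ℝ :=
  (p / (1 - p)) ^ edgeCount d

open scoped Classical in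
/-- Probability of the event `A` under `D(n,p)`. -/
noncomputable def prD (n : ℕ) (p : ℝ) (A : Dir n → Prop) : ℝ :=
  (∑ d : Dir n, if IsDAG d ∧ A d then dagWeight p d else 0) /
    (∑ d : Dir n, if IsDAG d then dagWeight p d else 0)

open scoped Classical in
/-- Expectation of `f` under `D(n,p)`. -/
noncomputable def expD (n : ℕ) (p : ℝ) (f : Dir n → ℝ) : ℝ :=
  (∑ d : Dir n, if IsDAG d then f d * dagWeight p d else 0) /
    (∑ d : Dir n, if IsDAG d then dagWeight p d else 0)

/-- Conditional probability of `A` given `B` under `D(n,p)`. -/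
noncomputable def condPrD (n : ℕ) (p : ℝ) (A B : Dir n → Prop) : ℝ :=
  prD n p (fun d => A d ∧ B d) / prD n p B

open scoped Classical in
/-- Expectation of `f` under the uniform distribution on ADMGs on `n` vertices. -/
noncomputable def expADMG (n : ℕ) (f : Dir n × Dir n → ℝ) : ℝ :=
  (∑ G : Dir n × Dir n, if IsADMG G.1 G.2 then f G else 0) /
    (∑ G : Dir n × Dir n, if IsADMG G.1 G.2 then (1 : ℝ) else 0)

open scoped Classical in
/-- Expectation of `f` under the uniform distribution on DCGs on `n` vertices. -/
noncomputable def expDCG (n : ℕ) (f : Dir n → ℝ) : ℝ :=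
  (∑ d : Dir n, if IsDCG d then f d else 0) /
    (∑ d : Dir n, if IsDCG d then (1 : ℝ) else 0)

open scoped Classical in
/-- Probability of the event `A` under the uniform distribution on DCGs on `n` vertices. -/
noncomputable def prDCG (n : ℕ) (A : Dir n → Prop) : ℝ :=
  (∑ d : Dir n, if IsDCG d ∧ A d then (1 : ℝ) else 0) /
    (∑ d : Dir n, if IsDCG d then (1 : ℝ) else 0)

/-! ### Tower decomposition -/

/-- The sources of `d` within a vertex set `S` (no parents inside `S`). -/
def sourcesIn {n : ℕ} (d : Dir n) (S : Finset (Fin n)) : Finset (Fin n) :=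
  S.filter fun v => ∀ u ∈ S, d u v = false

/-- The vertices remaining after peeling off `k` layers of sources. -/
def remaining {n : ℕ} (d : Dir n) : ℕ → Finset (Fin n)
  | 0 => Finset.univ
  | k + 1 => remaining d k \ sourcesIn d (remaining d k)

/-- The `i`-th layer (1-based) of the tower decomposition of `d`. -/
def towerLayer {n : ℕ} (d : Dir n) (i : ℕ) : Finset (Fin n) :=
  sourcesIn d (remaining d (i - 1))

/-- The 1-based index of the layer containing `v`. -/
def layerIdx {n : ℕ} (d : Dir n) (v : Fin n) : ℕ :=
  ((Finset.range n).filter fun j => v ∈ remaining d j).card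

/-- The tower of a DAG: only the edges between adjacent layers are kept. -/
def tower {n : ℕ} (d : Dir n) : Dir n :=
  fun a c => d a c && decide (layerIdx d c = layerIdx d a + 1)

/-- `h` is the tower vector of `d` (layer sizes, 1-based, and no further layers). -/
def hasTowerVector {n : ℕ} (d : Dir n) (h : List ℕ) : Prop :=
  (∀ i : Fin h.length, (towerLayer d (i.val + 1)).card = h.get i) ∧
    towerLayer d (h.length + 1) = ∅

/-- `H` is the tower decomposition of `d`. -/
def hasTowerDecomp {n : ℕ} (d : Dir n) (H : List (Finset (Fin n))) : Prop :=
  (∀ i : Fin H.length, towerLayer d (i.val + 1) = H.get i) ∧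
    towerLayer d (H.length + 1) = ∅

/-- The weight `w(h)` of a tower vector `h = (h_1, …, h_s)`. -/
noncomputable def towerWeight (p : ℝ) (h : List ℕ) : ℝ :=
  (Nat.multinomial Finset.univ (fun i : Fin h.length => h.get i) : ℝ) *
    ∏ k ∈ Finset.Icc 2 h.length,
      (1 - (1 - p) ^ h.getD (k - 2) 0) ^ h.getD (k - 1) 0 /
        (1 - p) ^ (h.getD (k - 1) 0 * ∑ i ∈ Finset.range (k - 1), h.getD i 0)

/-! ### Edge reversal and deletion -/

/-- Reverse the edge `v → w`. -/
def reverseEdge {n : ℕ} (d : Dir n) (v w : Fin n) : Dir n :=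
  fun a c => if a = v ∧ c = w then false else if a = w ∧ c = v then true else d a c

/-- Delete the edge `v → w`. -/
def deleteEdge {n : ℕ} (d : Dir n) (v w : Fin n) : Dir n :=
  fun a c => if a = v ∧ c = w then false else d a c

/-- The edge `v → w` of a DAG is reversible: reversing it yields a Markov-equivalent DAG. -/
def Reversible {n : ℕ} (d : Dir n) (v w : Fin n) : Prop :=
  d v w = true ∧ IsDAG (reverseEdge d v w) ∧ MarkovEquivD d (reverseEdge d v w)

/-- `d` has a matching of reversible layer-2-edges of size at least `m`. -/
def hasRevL2Matching {n : ℕ} (d : Dir n) (m : ℝ) : Prop :=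
  ∃ S : Finset (Fin n × Fin n),
    (∀ e ∈ S, Reversible d e.1 e.2 ∧ e.2 ∈ towerLayer d 2) ∧
    (∀ e ∈ S, ∀ e' ∈ S, e ≠ e' →
      e.1 ≠ e'.1 ∧ e.1 ≠ e'.2 ∧ e.2 ≠ e'.1 ∧ e.2 ≠ e'.2) ∧
    m ≤ (S.card : ℝ)

/-! ### Cycles and the `Reverse` construction -/

/-- Cyclic successor in `Fin k`. -/
def cycSucc {k : ℕ} (i : Fin k) : Fin k :=
  ⟨(i.val + 1) % k, Nat.mod_lt _ i.pos⟩

/-- The reversed parametrization of a cycle. -/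
def cycRev {n k : ℕ} (c : Fin k → Fin n) : Fin k → Fin n :=
  fun i => c ⟨(k - i.val) % k, Nat.mod_lt _ i.pos⟩

/-- `c` lists the (distinct) vertices of a directed cycle of `d`, in order. -/
def IsCycle {n k : ℕ} (d : Dir n) (c : Fin k → Fin n) : Prop :=
  Function.Injective c ∧ ∀ i, d (c i) (c (cycSucc i)) = true

/-- The `Reverse(G, C)` construction: reverse the cycle `c` and redirect every edge
`w → v_i` with `w ∈ Pa(v_i) \ {v_{i-1}}` to `w → v_{i-1}`. -/
def reverseCycle {n k : ℕ} (d : Dir n) (c : Fin k → Fin n) : Dir n :=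
  fun a e =>
    decide ((∃ j : Fin k, e = c j ∧
        (a = c (cycSucc j) ∨ (d a (c (cycSucc j)) = true ∧ a ≠ c j))) ∨
      ((∀ j : Fin k, e ≠ c j) ∧ d a e = true))

/-- A vertex triple induces exactly a directed 3-cycle. -/
def induces3Cycle {n : ℕ} (d : Dir n) (W : Finset (Fin n)) : Prop :=
  ∃ a b c : Fin n, W = {a, b, c} ∧ a ≠ b ∧ a ≠ c ∧ b ≠ c ∧
    d a b = true ∧ d b c = true ∧ d c a = true ∧
    d b a = false ∧ d c b = false ∧ d a c = false

/-! ### Moral-graph criterion for d-connection -/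

/-- `a` is a parent of `e` or `e` itself. -/
def ClosedParent {n : ℕ} (d : Dir n) (a e : Fin n) : Prop :=
  a = e ∨ d a e = true

/-- `a` is an ancestor of `Z`. -/
def AncOf {n : ℕ} (d : Dir n) (Z : Finset (Fin n)) (a : Fin n) : Prop :=
  ∃ x ∈ Z, Reach d a x

/-- `a` is an ancestor of `p`, of `q` or of `Z`. -/
def AncTriple {n : ℕ} (d : Dir n) (p q : Fin n) (Z : Finset (Fin n)) (a : Fin n) : Prop :=
  Reach d a p ∨ Reach d a q ∨ AncOf d Z a

/-- Adjacency outside `Z` in the moral graph of the ancestors of `p`, `q` and `Z`. -/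
def MoralAdj {n : ℕ} (d : Dir n) (p q : Fin n) (Z : Finset (Fin n)) (x y : Fin n) : Prop :=
  x ∉ Z ∧ y ∉ Z ∧ ∃ e, AncTriple d p q Z e ∧ ClosedParent d x e ∧ ClosedParent d y e

/-- A step of an active walk. The Boolean of a state records whether the walk arrived at the vertex
through an arrowhead. -/
def ActiveStep {n : ℕ} (d : Dir n) (Z : Finset (Fin n)) (s t : Fin n × Bool) : Prop :=
  (t.2 = true → d s.1 t.1 = true ∧ s.1 ∉ Z) ∧
  (t.2 = false → d t.1 s.1 = true ∧ (s.2 = true → AncOf d Z s.1) ∧ (s.2 = false → s.1 ∉ Z))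

theorem exists_seq_of_reflTransGen {α : Type*} {r : α → α → Prop} {a b : α}
    (h : Relation.ReflTransGen r a b) :
    ∃ (k : ℕ) (f : ℕ → α), f 0 = a ∧ f k = b ∧ ∀ i < k, r (f i) (f (i + 1)) := by
  induction h with
  | refl => exact ⟨0, fun _ => a, rfl, rfl, by simp⟩
  | @tail b c _ hbc ih =>
    obtain ⟨k, f, h0, hk, hf⟩ := ih
    refine ⟨k + 1, fun j => if j ≤ k then f j else c, by simp [h0], by simp, fun i hi => ?_⟩
    rcases Nat.lt_succ_iff_lt_or_eq.mp hi with h | rfl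
    · simpa [h.le, Nat.succ_le_of_lt h] using hf i h
    · simpa [hk] using hbc

theorem dConn_iff_activeStep {n : ℕ} (d : Dir n) {u v : Fin n} {Z : Finset (Fin n)} (hu : u ∉ Z) :
    DConn d (noBi n) u v Z ↔ ∃ b, Relation.ReflTransGen (ActiveStep d Z) (u, false) (v, b) := by
  constructor
  · rintro ⟨π, hπ⟩
    have key : ∀ i (hi : i ≤ π.len), ∃ b,
        Relation.ReflTransGen (ActiveStep d Z) (u, false) (π.vert ⟨i, by omega⟩, b) ∧
        ((i = 0 ∧ b = false) ∨ ∃ h : 0 < i, b = (π.kind ⟨i - 1, by omega⟩).intoSnd) := by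
      intro i
      induction i with
      | zero =>
        intro _
        refine ⟨false, ?_, Or.inl ⟨rfl, rfl⟩⟩
        have := π.first_eq
        rw [show (⟨0, by omega⟩ : Fin (π.len + 1)) = 0 from rfl, this]
      | succ i ih =>
        intro hi
        obtain ⟨b, hb, hb'⟩ := ih (by omega)
        refine ⟨(π.kind ⟨i, by omega⟩).intoSnd, hb.tail ?_, Or.inr ⟨by omega, by simp⟩⟩
        have hv := π.valid ⟨i, by omega⟩
        have ha := fun h : 0 < i => hπ i h (by omega)
        simp only [MPath.colliderAt, Fin.castSucc_mk, Fin.succ_mk] at hv ha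
        rcases hb' with ⟨rfl, rfl⟩ | ⟨h0, rfl⟩
        · have h1 : π.vert ⟨0, by omega⟩ = u := π.first_eq
          cases hk : π.kind ⟨0, by omega⟩ <;>
            simp_all [ActiveStep, EdgeKind.intoSnd, noBi]
        · have ha := ha h0
          cases hk : π.kind ⟨i, by omega⟩ <;>
            simp_all [ActiveStep, EdgeKind.intoSnd, EdgeKind.intoFst, noBi, AncOf]
    obtain ⟨b, hb, -⟩ := key π.len le_rfl
    have h1 : π.vert ⟨π.len, by omega⟩ = v := π.last_eq
    exact ⟨b, h1 ▸ hb⟩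
  · rintro ⟨b, hb⟩
    obtain ⟨k, f, h0, hk, hf⟩ := exists_seq_of_reflTransGen hb
    refine ⟨⟨k, fun i => (f i).1, fun i => if (f (i + 1)).2 = true then .fwd else .bwd,
      by simp [h0], by simp [hk], fun i => ?_⟩, fun i h1 h2 => ?_⟩
    · have := hf i i.2
      cases hc : (f (i + 1)).2 <;> simp_all [ActiveStep]
    · have := hf i h2
      simp only [MPath.colliderAt]
      rw [show i - 1 + 1 = i by omega]
      cases hc : (f (i + 1)).2 <;> cases hc' : (f i).2 <;>
        simp_all [ActiveStep, EdgeKind.intoSnd, EdgeKind.intoFst, AncOf]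

theorem AncTriple.of_edge {n : ℕ} {d : Dir n} {p q : Fin n} {Z : Finset (Fin n)} {a e : Fin n}
    (h : d a e = true) (he : AncTriple d p q Z e) : AncTriple d p q Z a := by
  rcases he with he | he | ⟨z, hz, he⟩
  · exact Or.inl (he.head h)
  · exact Or.inr (Or.inl (he.head h))
  · exact Or.inr (Or.inr ⟨z, hz, he.head h⟩)

theorem AncTriple.of_closedParent {n : ℕ} {d : Dir n} {p q : Fin n} {Z : Finset (Fin n)}
    {a e : Fin n} (h : ClosedParent d a e) (he : AncTriple d p q Z e) : AncTriple d p q Z a := by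
  rcases h with rfl | h
  · exact he
  · exact he.of_edge h

theorem moral_of_activeStep {n : ℕ} {d : Dir n} {u v : Fin n} {Z : Finset (Fin n)} (hv : v ∉ Z)
    {s t : Fin n × Bool} (ht : t.1 = v) (h : Relation.ReflTransGen (ActiveStep d Z) s t) :
    (s.2 = false → AncTriple d u v Z s.1 →
      s.1 ∉ Z ∧ Relation.ReflTransGen (MoralAdj d u v Z) s.1 v) ∧
    (s.2 = true → AncTriple d u v Z s.1 ∧
      ∀ p, p ∉ Z → ClosedParent d p s.1 → Relation.ReflTransGen (MoralAdj d u v Z) p v) := by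
  induction h using Relation.ReflTransGen.head_induction_on with
  | refl =>
    subst ht
    have hA : AncTriple d u t.1 Z t.1 := Or.inr (Or.inl .refl)
    exact ⟨fun _ _ => ⟨hv, .refl⟩, fun _ => ⟨hA, fun p hp hpv =>
      .single ⟨hp, hv, _, hA, hpv, Or.inl rfl⟩⟩⟩
  | @head s r hsr _ ih =>
    obtain ⟨x, b⟩ := s
    obtain ⟨y, c⟩ := r
    obtain ⟨h1, h2⟩ := hsr
    obtain ⟨ih1, ih2⟩ := ih
    cases c with
    | true =>
      obtain ⟨hxy, hx⟩ := h1 rfl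
      obtain ⟨hy, hM⟩ := ih2 rfl
      have hxv := hM x hx (Or.inr hxy)
      have hxA := hy.of_edge hxy
      exact ⟨fun _ _ => ⟨hx, hxv⟩, fun _ => ⟨hxA, fun p hp hpx =>
        hxv.head ⟨hp, hx, x, hxA, hpx, Or.inl rfl⟩⟩⟩
    | false =>
      obtain ⟨hyx, hb1, hb2⟩ := h2 rfl
      refine ⟨fun hb hxA => ?_, fun hb => ?_⟩
      · have hx := hb2 hb
        obtain ⟨hy, hM⟩ := ih1 rfl (hxA.of_edge hyx)
        exact ⟨hx, hM.head ⟨hx, hy, x, hxA, Or.inl rfl, Or.inr hyx⟩⟩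
      · have hxA : AncTriple d u v Z x := Or.inr (Or.inr (hb1 hb))
        obtain ⟨hy, hM⟩ := ih1 rfl (hxA.of_edge hyx)
        exact ⟨hxA, fun p hp hpx => hM.head ⟨hp, hy, x, hxA, hpx, Or.inr hyx⟩⟩

/-- A directed walk that starts outside the ancestors of `Z` is active. -/
theorem activeStep_of_reach {n : ℕ} {d : Dir n} {Z : Finset (Fin n)} {x y : Fin n}
    (h : Reach d x y) (hx : ¬ AncOf d Z x) (b : Bool) :
    ∃ c, Relation.ReflTransGen (ActiveStep d Z) (x, b) (y, c) := by
  induction h using Relation.ReflTransGen.head_induction_on generalizing b with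
  | refl => exact ⟨b, .refl⟩
  | @head x w hxw _ ih =>
    obtain ⟨c, hc⟩ := ih (fun ⟨z, hz, hw⟩ => hx ⟨z, hz, hw.head hxw⟩) true
    exact ⟨c, hc.head ⟨fun _ => ⟨hxw, fun hz => hx ⟨x, hz, .refl⟩⟩, by simp⟩⟩

/-- A directed walk from `x`, traversed backwards, is active if `x` is not an ancestor of `Z`. -/
theorem activeStep_of_reach_rev {n : ℕ} {d : Dir n} {Z : Finset (Fin n)} {x y : Fin n}
    (h : Reach d x y) (hx : ¬ AncOf d Z x) :
    Relation.ReflTransGen (ActiveStep d Z) (y, false) (x, false) := by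
  induction h using Relation.ReflTransGen.head_induction_on with
  | refl => exact .refl
  | @head x w hxw _ ih =>
    have hw : ¬ AncOf d Z w := fun ⟨z, hz, hw⟩ => hx ⟨z, hz, hw.head hxw⟩
    exact (ih hw).tail ⟨by simp, fun _ => ⟨hxw, by simp, fun _ hz => hw ⟨w, hz, .refl⟩⟩⟩

theorem activeStep_of_moral {n : ℕ} {d : Dir n} {u v : Fin n} {Z : Finset (Fin n)}
    (hu : u ∉ Z) (h : Relation.ReflTransGen (MoralAdj d u v Z) u v) :
    ∃ b, Relation.ReflTransGen (ActiveStep d Z) (u, false) (v, b) := by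
  by_contra hgoal
  have fix : ∀ x b, AncTriple d u v Z x → (b = false → x ∉ Z) →
      Relation.ReflTransGen (ActiveStep d Z) (u, false) (x, b) →
      (Relation.ReflTransGen (ActiveStep d Z) (u, false) (x, true) ∧ AncOf d Z x) ∨
      (Relation.ReflTransGen (ActiveStep d Z) (u, false) (x, false) ∧ x ∉ Z) := by
    intro x b hA hb hx
    by_cases hxZ : AncOf d Z x
    · cases b with
      | false => exact Or.inr ⟨hx, hb rfl⟩
      | true => exact Or.inl ⟨hx, hxZ⟩
    · rcases hA with hA | hA | hA
      · exact Or.inr ⟨activeStep_of_reach_rev hA hxZ, fun hz => hxZ ⟨x, hz, .refl⟩⟩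
      · obtain ⟨c, hc⟩ := activeStep_of_reach hA hxZ b
        exact (hgoal ⟨c, hx.trans hc⟩).elim
      · exact (hxZ hA).elim
  have key : ∀ w, Relation.ReflTransGen (MoralAdj d u v Z) u w →
      (Relation.ReflTransGen (ActiveStep d Z) (u, false) (w, true) ∧ AncOf d Z w) ∨
      (Relation.ReflTransGen (ActiveStep d Z) (u, false) (w, false) ∧ w ∉ Z) := by
    intro w hw
    induction hw with
    | refl => exact Or.inr ⟨.refl, hu⟩
    | @tail x y _ hxy ih =>
      obtain ⟨hx, hy, e, he, hxe, hye⟩ := hxy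
      have hGe : (Relation.ReflTransGen (ActiveStep d Z) (u, false) (e, true) ∧ AncOf d Z e) ∨
          (Relation.ReflTransGen (ActiveStep d Z) (u, false) (e, false) ∧ e ∉ Z) := by
        rcases hxe with rfl | hxe
        · exact ih
        · have hstep : ∀ b, ActiveStep d Z (x, b) (e, true) := fun b =>
            ⟨fun _ => ⟨hxe, hx⟩, by simp⟩
          refine fix e true he (by simp) ?_
          rcases ih with h | h
          · exact h.1.tail (hstep _)
          · exact h.1.tail (hstep _)
      rcases hye with rfl | hye
      · exact hGe
      · refine Or.inr ⟨?_, hy⟩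
        rcases hGe with h | h
        · exact h.1.tail ⟨by simp, fun _ => ⟨hye, fun _ => h.2, by simp⟩⟩
        · exact h.1.tail ⟨by simp, fun _ => ⟨hye, by simp, fun _ => h.2⟩⟩
  rcases key v h with h | h
  · exact hgoal ⟨_, h.1⟩
  · exact hgoal ⟨_, h.1⟩

/-- d-connection is connectivity outside `Z` in the moral graph of the relevant ancestors. -/
theorem dConn_iff_moral {n : ℕ} (d : Dir n) {u v : Fin n} {Z : Finset (Fin n)}
    (hu : u ∉ Z) (hv : v ∉ Z) :
    DConn d (noBi n) u v Z ↔ Relation.ReflTransGen (MoralAdj d u v Z) u v := by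
  rw [dConn_iff_activeStep d hu]
  exact ⟨fun ⟨_, hb⟩ => ((moral_of_activeStep hv rfl hb).1 rfl (Or.inl .refl)).2,
    activeStep_of_moral hu⟩

theorem MarkovEquivD.refl {n : ℕ} (d : Dir n) : MarkovEquivD d d :=
  fun _ _ _ _ _ _ => Iff.rfl

theorem MarkovEquivD.trans {n : ℕ} {d₁ d₂ d₃ : Dir n} (h : MarkovEquivD d₁ d₂)
    (h' : MarkovEquivD d₂ d₃) : MarkovEquivD d₁ d₃ :=
  fun u v Z huv hu hv => (h u v Z huv hu hv).trans (h' u v Z huv hu hv)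

/-! ### Permuting closed parent sets -/

theorem reach_perm {n : ℕ} {d d' : Dir n} {σ : Equiv.Perm (Fin n)}
    (h : ∀ a e, ClosedParent d' a e ↔ ClosedParent d a (σ e)) (e : Fin n) :
    Reach d e (σ e) ∧ Reach d (σ e) e := by
  have hcp : ∀ a b, ClosedParent d a b → Reach d a b := by
    rintro a b (rfl | hab)
    · exact .refl
    · exact .single hab
  have hpow : ∀ (k : ℕ) (a : Fin n), Reach d a ((σ ^ k) a) := by
    intro k
    induction k with
    | zero => exact fun a => .refl
    | succ k ih =>
      intro a
      rw [pow_succ']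
      exact (ih a).trans (hcp _ _ ((h _ _).1 (Or.inl rfl)))
  refine ⟨by simpa using hpow 1 e, ?_⟩
  have := hpow (orderOf σ - 1) (σ e)
  rwa [← Equiv.Perm.mul_apply, ← pow_succ, Nat.sub_add_cancel (orderOf_pos σ), pow_orderOf_eq_one,
    Equiv.Perm.one_apply] at this

theorem reach_of_reach_perm {n : ℕ} {d d' : Dir n} {σ : Equiv.Perm (Fin n)}
    (h : ∀ a e, ClosedParent d' a e ↔ ClosedParent d a (σ e)) {a b : Fin n} (hab : Reach d' a b) :
    Reach d a b := by
  induction hab with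
  | refl => exact .refl
  | @tail x y _ hxy ih =>
    refine ih.trans (Relation.ReflTransGen.trans ?_ (reach_perm h y).2)
    rcases (h x y).1 (Or.inr hxy) with h | h
    · rw [h]
    · exact .single h

theorem moralAdj_of_perm {n : ℕ} {d d' : Dir n} {σ : Equiv.Perm (Fin n)}
    (h : ∀ a e, ClosedParent d' a e ↔ ClosedParent d a (σ e)) {p q : Fin n} {Z : Finset (Fin n)}
    {x y : Fin n} (hxy : MoralAdj d' p q Z x y) : MoralAdj d p q Z x y := by
  obtain ⟨hx, hy, e, he, hxe, hye⟩ := hxy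
  refine ⟨hx, hy, σ e, ?_, (h _ _).1 hxe, (h _ _).1 hye⟩
  have hr : ∀ t, Reach d' e t → Reach d (σ e) t := fun t ht =>
    (reach_perm h e).2.trans (reach_of_reach_perm h ht)
  rcases he with he | he | ⟨z, hz, he⟩
  · exact Or.inl (hr _ he)
  · exact Or.inr (Or.inl (hr _ he))
  · exact Or.inr (Or.inr ⟨z, hz, hr _ he⟩)

theorem markovEquivD_of_perm {n : ℕ} {d d' : Dir n} {σ : Equiv.Perm (Fin n)}
    (h : ∀ a e, ClosedParent d' a e ↔ ClosedParent d a (σ e)) : MarkovEquivD d d' := by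
  have h' : ∀ a e, ClosedParent d a e ↔ ClosedParent d' a (σ⁻¹ e) := fun a e => by
    rw [h]
    simp
  intro u v Z _ hu hv
  rw [dConn_iff_moral d hu hv, dConn_iff_moral d' hu hv]
  exact ⟨Relation.ReflTransGen.mono (fun _ _ => moralAdj_of_perm h') u v,
    Relation.ReflTransGen.mono (fun _ _ => moralAdj_of_perm h) u v⟩

/-! ### Deleting an edge between vertices with equal closed parent sets -/

theorem closedParent_deleteEdge {n : ℕ} {d : Dir n} {v w a e : Fin n} (h : ¬ (a = v ∧ e = w)) :
    ClosedParent (deleteEdge d v w) a e ↔ ClosedParent d a e := by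
  simp [ClosedParent, deleteEdge, h]

theorem deleteEdge_le {n : ℕ} {d : Dir n} {v w a e : Fin n} (h : deleteEdge d v w a e = true) :
    d a e = true := by
  unfold deleteEdge at h
  split_ifs at h
  exact h

theorem ancTriple_deleteEdge {n : ℕ} {d : Dir n} (hd : IsDCG d) {v w : Fin n}
    (h : ∀ a, ClosedParent d a v ↔ ClosedParent d a w) {p q : Fin n} {Z : Finset (Fin n)}
    {x : Fin n} (hx : AncTriple d p q Z x) :
    AncTriple (deleteEdge d v w) p q Z x ∨
      (x = v ∧ AncTriple (deleteEdge d v w) p q Z w) := by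
  have main : ∀ t, AncTriple (deleteEdge d v w) p q Z t → Reach d x t →
      AncTriple (deleteEdge d v w) p q Z x ∨
        (x = v ∧ AncTriple (deleteEdge d v w) p q Z w) := by
    clear hx
    intro t ht hxt
    induction hxt using Relation.ReflTransGen.head_induction_on with
    | refl => exact Or.inl ht
    | @head x y hxy _ ih =>
      rcases ih with hy | ⟨rfl, hw⟩
      · by_cases hc : x = v ∧ y = w
        · exact Or.inr ⟨hc.1, hc.2 ▸ hy⟩
        · exact Or.inl (hy.of_closedParent ((closedParent_deleteEdge hc).2 (Or.inr hxy)))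
      · have hxv : x ≠ y := by
          rintro rfl
          simp [hd x] at hxy
        exact Or.inl (hw.of_closedParent
          ((closedParent_deleteEdge fun hc => hxv hc.1).2 ((h x).1 (Or.inr hxy))))
  rcases hx with hx | hx | ⟨z, hz, hx⟩
  · exact main p (Or.inl .refl) hx
  · exact main q (Or.inr (Or.inl .refl)) hx
  · exact main z (Or.inr (Or.inr ⟨z, hz, .refl⟩)) hx

theorem moralAdj_of_deleteEdge {n : ℕ} {d : Dir n} {v w p q : Fin n} {Z : Finset (Fin n)}
    {x y : Fin n} (h : MoralAdj (deleteEdge d v w) p q Z x y) : MoralAdj d p q Z x y := by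
  obtain ⟨hx, hy, e, he, hxe, hye⟩ := h
  have hr : ∀ t, Reach (deleteEdge d v w) e t → Reach d e t := fun t =>
    Relation.ReflTransGen.mono (fun _ _ => deleteEdge_le) e t
  refine ⟨hx, hy, e, ?_, hxe.imp_right deleteEdge_le, hye.imp_right deleteEdge_le⟩
  rcases he with he | he | ⟨z, hz, he⟩
  · exact Or.inl (hr _ he)
  · exact Or.inr (Or.inl (hr _ he))
  · exact Or.inr (Or.inr ⟨z, hz, hr _ he⟩)

theorem moral_deleteEdge {n : ℕ} {d : Dir n} (hd : IsDCG d) {v w : Fin n} (hvw : v ≠ w)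
    (h : ∀ a, ClosedParent d a v ↔ ClosedParent d a w) {p q : Fin n} {Z : Finset (Fin n)}
    (hM : Relation.ReflTransGen (MoralAdj d p q Z) p q) :
    Relation.ReflTransGen (MoralAdj (deleteEdge d v w) p q Z) p q := by
  by_cases hvA : AncTriple (deleteEdge d v w) p q Z v
  · refine Relation.ReflTransGen.mono ?_ p q hM
    rintro x y ⟨hx, hy, e, he, hxe, hye⟩
    by_cases hew : e = w
    · subst hew
      exact ⟨hx, hy, v, hvA, (closedParent_deleteEdge fun hc => hvw hc.2).2 ((h _).2 hxe),
        (closedParent_deleteEdge fun hc => hvw hc.2).2 ((h _).2 hye)⟩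
    · refine ⟨hx, hy, e, ?_, (closedParent_deleteEdge fun hc => hew hc.2).2 hxe,
        (closedParent_deleteEdge fun hc => hew hc.2).2 hye⟩
      rcases ancTriple_deleteEdge hd h he with he | ⟨rfl, -⟩
      · exact he
      · exact hvA
  · have hp : p ≠ v := by
      rintro rfl
      exact hvA (Or.inl .refl)
    have hq : q ≠ v := by
      rintro rfl
      exact hvA (Or.inr (Or.inl .refl))
    have hdel : ∀ x e, x ≠ v → (ClosedParent (deleteEdge d v w) x e ↔ ClosedParent d x e) :=
      fun x e hx => closedParent_deleteEdge fun hc => hx hc.1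
    have key : ∀ x, Relation.ReflTransGen (MoralAdj d p q Z) x q →
        (x ≠ v → Relation.ReflTransGen (MoralAdj (deleteEdge d v w) p q Z) x q) ∧
        (x = v → ∀ y, y ∉ Z → y ≠ v → ClosedParent d y v →
          Relation.ReflTransGen (MoralAdj (deleteEdge d v w) p q Z) y q) := by
      intro x hx
      induction hx using Relation.ReflTransGen.head_induction_on with
      | refl => exact ⟨fun _ => .refl, fun h => (hq h).elim⟩
      | @head x y hxy _ ih =>
        obtain ⟨hx, hy, e, he, hxe, hye⟩ := hxy
        have he' : ∃ e', AncTriple (deleteEdge d v w) p q Z e' ∧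
            (∀ z, ClosedParent d z e → ClosedParent d z e') ∧
            (ClosedParent d v e' → e' = w) := by
          rcases ancTriple_deleteEdge hd h he with he | ⟨rfl, hw⟩
          · refine ⟨e, he, fun _ => id, fun hve => ?_⟩
            by_contra hew
            exact hvA (he.of_closedParent ((closedParent_deleteEdge fun hc => hew hc.2).2 hve))
          · exact ⟨w, hw, fun z hz => (h z).1 hz, fun _ => rfl⟩
        obtain ⟨f, hf, hef, hfw⟩ := he'
        have hxf := hef x hxe
        have hyf := hef y hye
        by_cases hyv : y = v
        · subst hyv
          obtain rfl := hfw hyf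
          exact ⟨fun hxy => ih.2 rfl x hx hxy ((h x).2 hxf), fun _ => ih.2 rfl⟩
        · have hyq := ih.1 hyv
          refine ⟨fun hxv => hyq.head ⟨hx, hy, f, hf, (hdel _ _ hxv).2 hxf, (hdel _ _ hyv).2 hyf⟩,
            ?_⟩
          rintro rfl z hz hzx hzv
          obtain rfl := hfw hxf
          exact hyq.head ⟨hz, hy, f, hf, (hdel _ _ hzx).2 ((h z).1 hzv), (hdel _ _ hyv).2 hyf⟩
    exact (key p hM).1 hp

theorem markovEquivD_deleteEdge {n : ℕ} {d : Dir n} (hd : IsDCG d) {v w : Fin n} (hvw : v ≠ w)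
    (h : ∀ a, ClosedParent d a v ↔ ClosedParent d a w) : MarkovEquivD d (deleteEdge d v w) := by
  intro p q Z _ hp hq
  rw [dConn_iff_moral _ hp hq, dConn_iff_moral _ hp hq]
  exact ⟨moral_deleteEdge hd hvw h,
    Relation.ReflTransGen.mono (fun _ _ => moralAdj_of_deleteEdge) p q⟩

/-! ### Modifying a graph along disjoint cycles -/

theorem cycSucc_injective {k : ℕ} : Function.Injective (cycSucc : Fin k → Fin k) := by
  intro i j hij
  have h : (i.val + 1) ≡ (j.val + 1) [MOD k] := congrArg Fin.val hij
  exact Fin.ext ((Nat.ModEq.add_right_cancel' 1 h).eq_of_lt_of_lt i.2 j.2)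

/-- A graph with a cycle has a Markov equivalent graph that differs from it, but only in edges into
vertices of the cycle. -/
theorem exists_markovEquivD_of_isCycle {n k : ℕ} {d : Dir n} (hd : IsDCG d) (hk : 0 < k)
    {c : Fin k → Fin n} (hc : IsCycle d c) :
    ∃ d' : Dir n, IsDCG d' ∧ MarkovEquivD d d' ∧ d' ≠ d ∧
      ∀ e, (∀ j, e ≠ c j) → ∀ a, d' a e = d a e := by
  classical
  obtain ⟨hinj, hedge⟩ := hc
  let τ : Equiv.Perm (Fin k) :=
    Equiv.ofBijective cycSucc (Finite.injective_iff_bijective.1 cycSucc_injective)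
  let σ : Equiv.Perm (Fin n) := τ.viaFintypeEmbedding ⟨c, hinj⟩
  have hσc : ∀ j, σ (c j) = c (cycSucc j) := fun j =>
    Equiv.Perm.viaFintypeEmbedding_apply_image τ ⟨c, hinj⟩ j
  have hσ : ∀ e, (∀ j, e ≠ c j) → σ e = e := fun e he =>
    Equiv.Perm.viaFintypeEmbedding_apply_notMem_range τ ⟨c, hinj⟩
      (by rintro ⟨j, rfl⟩; exact he j rfl)
  let r : Dir n := fun a e => decide (a ≠ e ∧ ClosedParent d a (σ e))
  have hr : ∀ a e, ClosedParent r a e ↔ ClosedParent d a (σ e) := by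
    intro a e
    by_cases hae : a = e
    · subst hae
      refine ⟨fun _ => ?_, fun _ => Or.inl rfl⟩
      by_cases ha : ∃ j, a = c j
      · obtain ⟨j, rfl⟩ := ha
        exact Or.inr (hσc j ▸ hedge j)
      · exact Or.inl (hσ a fun j hj => ha ⟨j, hj⟩).symm
    · simp [ClosedParent, r, hae]
  by_cases hrd : r = d
  · rw [hrd] at hr
    let z : Fin k := ⟨0, hk⟩
    have hne : c z ≠ c (cycSucc z) := fun h => by
      have := hedge z
      rw [← h, hd] at this
      exact Bool.false_ne_true this
    refine ⟨deleteEdge d (c z) (c (cycSucc z)), fun v => ?_,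
      markovEquivD_deleteEdge hd hne fun a => ?_, fun h => ?_, fun e he a => ?_⟩
    · have := hd v
      by_contra hv
      rw [deleteEdge_le (Bool.eq_true_of_not_eq_false hv)] at this
      exact Bool.false_ne_true this.symm
    · rw [hr, hσc]
    · have := hedge z
      rw [← h] at this
      simp [deleteEdge] at this
    · simp [deleteEdge, he]
  · refine ⟨r, fun v => by simp [r], markovEquivD_of_perm hr, hrd, fun e he a => ?_⟩
    rw [Bool.eq_iff_iff]
    by_cases hae : a = e
    · subst hae
      simp [r, hd a]
    · simp [r, hσ e he, ClosedParent, hae]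

theorem two_pow_le_ncard_of_disjoint_cycles {n m : ℕ} {d : Dir n} (hd : IsDCG d)
    {L : Fin m → ℕ} (hL : ∀ i, 0 < L i) {c : (i : Fin m) → Fin (L i) → Fin n}
    (hcyc : ∀ i, IsCycle d (c i)) (hdisj : ∀ i j, i ≠ j → ∀ a b, c i a ≠ c j b) :
    2 ^ m ≤ {d' | d' ∈ MECdcg d ∧ ∀ e, (∀ i j, e ≠ c i j) → ∀ a, d' a e = d a e}.ncard := by
  induction m generalizing d with
  | zero =>
    have : d ∈ {d' | d' ∈ MECdcg d ∧ ∀ e, (∀ i j, e ≠ c i j) → ∀ a, d' a e = d a e} :=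
      ⟨⟨hd, .refl d⟩, fun _ _ _ => rfl⟩
    exact (Set.ncard_pos (Set.toFinite _)).2 ⟨d, this⟩
  | succ m ih =>
    obtain ⟨d₁, hd₁, hequiv, hne, hout⟩ := exists_markovEquivD_of_isCycle hd (hL 0) (hcyc 0)
    have hcyc₁ : ∀ i : Fin m, IsCycle d₁ (c i.succ) := fun i =>
      ⟨(hcyc i.succ).1, fun j => by
        rw [hout _ fun j' => hdisj _ _ (Fin.succ_ne_zero i) _ _]
        exact (hcyc i.succ).2 j⟩
    have hdisj' : ∀ i j : Fin m, i ≠ j → ∀ a b, c i.succ a ≠ c j.succ b := fun i j hij =>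
      hdisj _ _ fun h => hij (Fin.succ_injective _ h)
    have ih₀ := ih (c := fun i => c i.succ) hd (fun i => hL i.succ) (fun i => hcyc i.succ) hdisj'
    have ih₁ := ih (c := fun i => c i.succ) hd₁ (fun i => hL i.succ) hcyc₁ hdisj'
    rw [pow_succ, mul_two]
    refine (add_le_add ih₀ ih₁).trans ?_
    rw [← Set.ncard_union_eq ?_ (Set.toFinite _) (Set.toFinite _)]
    · refine Set.ncard_le_ncard ?_ (Set.toFinite _)
      rintro g (⟨hg, hg'⟩ | ⟨hg, hg'⟩)
      · exact ⟨hg, fun e he a => hg' e (fun i => he i.succ) a⟩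
      · exact ⟨⟨hg.1, hequiv.trans hg.2⟩, fun e he a =>
          (hg' e (fun i => he i.succ) a).trans (hout e (he 0) a)⟩
    · refine Set.disjoint_left.2 fun g hg hg₁ => hne ?_
      funext a e
      by_cases he : ∃ j, e = c 0 j
      · obtain ⟨j, rfl⟩ := he
        have hcol : ∀ (i : Fin m) j', c 0 j ≠ c i.succ j' := fun i j' =>
          hdisj _ _ (Fin.succ_ne_zero i).symm _ _
        exact (hg₁.2 _ hcol a).symm.trans (hg.2 _ hcol a)
      · exact hout e (fun j hj => he ⟨j, hj⟩) a

/-- Corollary 5.3: a DCG containing `m` pairwise vertex-disjoint directed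
cycles, each of length at least `3`, has `|MEC(G)| ≥ 2 ^ m`. -/
theorem disjoint_cycles_mec_lower_bound (n m : ℕ) (d : Dir n) (hd : IsDCG d)
    (L : Fin m → ℕ) (hL : ∀ i, 3 ≤ L i)
    (c : (i : Fin m) → Fin (L i) → Fin n)
    (hcyc : ∀ i, IsCycle d (c i))
    (hdisj : ∀ i j, i ≠ j → ∀ a b, c i a ≠ c j b) :
    2 ^ m ≤ (MECdcg d).ncard := by
  exact (two_pow_le_ncard_of_disjoint_cycles hd (fun i => by have := hL i; omega) hcyc hdisj).trans
    (Set.ncard_le_ncard (fun _ h => h.1) (Set.toFinite _))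

end CausalMEC
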